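/- Let (λ_n)_{n≥1} be a strictly increasing sequence of positive reals with λ_n → ∞. Let K, K̃ be positive integers, let 0 ≤ t_0 < t_1 < … < t_K and 0 ≤ t̃_0 < t̃_1 < … < t̃_{K̃} be meshes, and for 1 ≤ k ≤ K (resp. 1 ≤ k ≤ K̃) let a_k : ℕ → ℂ (resp. ã_k : ℕ → ℂ) satisfy ∑_k ∑_n |a_{k,n}| < ∞ and ∑_k ∑_n |ã_{k,n}| < ∞, with a_k ≠ 0 and a_k ≠ a_{k+1} (as sequences in ℕ → ℂ) for each admissible k, and likewise for ã. If for every s ∈ ℂ with Re s > 0: ∑_{k=1}^K (e^{−t_{k−1}s} − e^{−t_k s}) ∑_{n=1}^∞ a_{k,n} λ_n (s + λ_n)^{−1} = ∑_{k=1}^{K̃} (e^{−t̃_{k−1}s} − e^{−t̃_k s}) ∑_{n=1}^∞ ã_{k,n} λ_n (s + λ_n)^{−1}, then K = K̃, t_k = t̃_k for 0 ≤ k ≤ K, and a_k = ã_k for 1 ≤ k ≤ K. -/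

import Mathlib

open Filter Topology MeasureTheory

/-- The exponential density with rate `l`, averaged against the smooth cutoff
`t ↦ 1 - exp (-exp (s * (x - t)))`, which tends to the indicator of `t < x` as `s → ∞`. -/
noncomputable def smoothedExpCDF (l x s : ℝ) : ℝ :=
  ∫ t in Set.Ioi (0 : ℝ), l * Real.exp (-l * t) * (1 - Real.exp (-Real.exp (s * (x - t))))

theorem hasSum_one_sub_exp_neg (y : ℝ) :
    HasSum (fun k : ℕ => (-1) ^ k / ((k + 1).factorial : ℝ) * y ^ (k + 1)) (1 - Real.exp (-y)) := by
  have h := NormedSpace.expSeries_div_hasSum_exp (-y)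
  rw [← Real.exp_eq_exp_ℝ, ← hasSum_nat_add_iff' 1] at h
  rw [← neg_sub]
  simp only [Finset.sum_range_one, pow_zero, Nat.factorial_zero, Nat.cast_one, div_one] at h
  refine (congrArg (HasSum · _) (funext fun k => ?_)).mp h.neg
  rw [neg_pow, pow_succ (-1 : ℝ) k]
  ring

theorem integrableOn_exp_density {l : ℝ} (hl : 0 < l) :
    IntegrableOn (fun t : ℝ => l * Real.exp (-l * t)) (Set.Ioi 0) :=
  (integrableOn_exp_mul_Ioi (neg_lt_zero.2 hl) 0).const_mul l

theorem integral_exp_density {l : ℝ} (hl : 0 < l) :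
    ∫ t in Set.Ioi (0 : ℝ), l * Real.exp (-l * t) = 1 := by
  rw [integral_const_mul, integral_exp_mul_Ioi (neg_lt_zero.2 hl)]
  simp [hl.ne']

theorem norm_exp_density_mul_cutoff_le {l : ℝ} (hl : 0 < l) (t u : ℝ) :
    ‖l * Real.exp (-l * t) * (1 - Real.exp (-Real.exp u))‖ ≤ l * Real.exp (-l * t) := by
  have h1 : Real.exp (-Real.exp u) ≤ 1 := Real.exp_le_one_iff.2 (by linarith [Real.exp_pos u])
  have h2 := Real.exp_pos (-Real.exp u)
  have h3 : 0 < l * Real.exp (-l * t) := mul_pos hl (Real.exp_pos _)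
  rw [norm_mul, Real.norm_of_nonneg h3.le, Real.norm_of_nonneg (by linarith)]
  exact mul_le_of_le_one_right h3.le (by linarith)

theorem norm_smoothedExpCDF_le {l : ℝ} (hl : 0 < l) (x s : ℝ) :
    ‖smoothedExpCDF l x s‖ ≤ 1 := by
  rw [← integral_exp_density hl]
  exact norm_integral_le_of_norm_le (integrableOn_exp_density hl)
    (Eventually.of_forall fun t => norm_exp_density_mul_cutoff_le hl t _)

theorem hasSum_smoothedExpCDF {l s : ℝ} (hl : 0 < l) (hs : 0 < s) (x : ℝ) :
    HasSum (fun k : ℕ => (-1) ^ k / ((k + 1).factorial : ℝ) * Real.exp (s * x) ^ (k + 1) *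
      (l / ((k + 1) * s + l))) (smoothedExpCDF l x s) := by
  set c : ℕ → ℝ := fun k => (-1) ^ k / ((k + 1).factorial : ℝ) * Real.exp (s * x) ^ (k + 1)
  have hr : ∀ k : ℕ, -((k + 1) * s + l) < 0 := fun k => neg_lt_zero.2 (by positivity)
  have hint : ∀ k : ℕ, ∫ t in Set.Ioi (0 : ℝ), Real.exp (-((k + 1) * s + l) * t)
      = 1 / ((k + 1) * s + l) := by
    intro k
    rw [integral_exp_mul_Ioi (hr k), mul_zero, Real.exp_zero, neg_div_neg_eq]
  have key := hasSum_integral_of_summable_integral_norm (μ := volume.restrict (Set.Ioi (0 : ℝ)))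
    (F := fun (k : ℕ) (t : ℝ) => c k * l * Real.exp (-((k + 1) * s + l) * t))
    (fun k => (integrableOn_exp_mul_Ioi (hr k) 0).const_mul _) ?_
  · have hval : smoothedExpCDF l x s = ∫ t in Set.Ioi (0 : ℝ),
        ∑' k : ℕ, c k * l * Real.exp (-((k + 1) * s + l) * t) := by
      refine integral_congr_ae (Eventually.of_forall fun t => ?_)
      have h := (hasSum_one_sub_exp_neg (Real.exp (s * (x - t)))).mul_left (l * Real.exp (-l * t))
      refine h.tsum_eq.symm.trans ?_
      refine tsum_congr fun k => ?_
      have : Real.exp (-((k + 1) * s + l) * t) = Real.exp (-(s * t)) ^ (k + 1) * Real.exp (-l * t) := by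
        rw [← Real.exp_nat_mul, ← Real.exp_add]
        push_cast
        ring_nf
      rw [this, show s * (x - t) = s * x + -(s * t) by ring, Real.exp_add, mul_pow]
      simp only [c]
      ring
    rw [hval]
    refine (congrArg (HasSum · _) (funext fun k => ?_)).mp key
    rw [integral_const_mul, hint]
    ring
  · have hsum : Summable fun k : ℕ => Real.exp (s * x) ^ (k + 1) / ((k + 1).factorial : ℝ) :=
      (summable_nat_add_iff 1).2 (Real.summable_pow_div_factorial (Real.exp (s * x)))
    refine Summable.of_nonneg_of_le (fun k => integral_nonneg fun t => norm_nonneg _)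
      (fun k => ?_) hsum
    simp_rw [norm_mul, Real.norm_of_nonneg (Real.exp_nonneg _), integral_const_mul, hint]
    have hden : l / ((k + 1) * s + l) ≤ 1 := by
      rw [div_le_one (by positivity)]
      have : 0 < (k + 1) * s := by positivity
      linarith
    have hc : ‖c k‖ = Real.exp (s * x) ^ (k + 1) / ((k + 1).factorial : ℝ) := by
      rw [norm_mul, norm_div, norm_pow, norm_neg, norm_one, one_pow,
        Real.norm_of_nonneg (by positivity), Real.norm_of_nonneg (by positivity)]
      ring
    rw [Real.norm_of_nonneg hl.le, mul_assoc, mul_one_div, hc]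
    exact mul_le_of_le_one_right (by positivity) hden

theorem tendsto_smoothedExpCDF {l x : ℝ} (hl : 0 < l) (hx : 0 < x) :
    Tendsto (smoothedExpCDF l x) atTop (𝓝 (1 - Real.exp (-l * x))) := by
  have hlim : ∫ t in Set.Ioi (0 : ℝ), (Set.Iio x).indicator (fun t => l * Real.exp (-l * t)) t
      = 1 - Real.exp (-l * x) := by
    rw [setIntegral_indicator measurableSet_Iio, Set.Ioi_inter_Iio, ← integral_Ioc_eq_integral_Ioo,
      ← intervalIntegral.integral_of_le hx.le,
      intervalIntegral.integral_eq_sub_of_hasDerivAt (f := fun t => -Real.exp (-l * t))]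
    · simp
      ring
    · intro t _
      have := (((hasDerivAt_id t).const_mul (-l)).exp).neg
      refine HasDerivAt.congr_deriv this ?_
      simp only [id]
      ring
    · exact (by fun_prop : Continuous fun t : ℝ => l * Real.exp (-l * t)).intervalIntegrable _ _
  rw [← hlim]
  refine tendsto_integral_filter_of_dominated_convergence (fun t => l * Real.exp (-l * t))
    (Eventually.of_forall fun s => ?_)
    (Eventually.of_forall fun s => Eventually.of_forall fun t =>
      norm_exp_density_mul_cutoff_le hl t _) (integrableOn_exp_density hl) ?_
  · exact (by fun_prop : Continuous fun t : ℝ =>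
      l * Real.exp (-l * t) * (1 - Real.exp (-Real.exp (s * (x - t))))).aestronglyMeasurable
  · have hne : ∀ᵐ t ∂(volume.restrict (Set.Ioi (0 : ℝ))), t ≠ x :=
      ae_restrict_of_ae (Measure.ae_ne volume x)
    filter_upwards [hne] with t ht
    rcases lt_or_gt_of_ne ht with h | h
    · rw [Set.indicator_of_mem (Set.mem_Iio.2 h)]
      have h1 : Tendsto (fun s : ℝ => s * (x - t)) atTop atTop :=
        tendsto_id.atTop_mul_const (sub_pos.2 h)
      have h2 := Real.tendsto_exp_neg_atTop_nhds_zero.comp (Real.tendsto_exp_atTop.comp h1)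
      simpa [Function.comp_def] using (h2.const_sub 1).const_mul (l * Real.exp (-l * t))
    · rw [Set.indicator_of_notMem (by simpa using h.le)]
      have h1 : Tendsto (fun s : ℝ => s * (x - t)) atTop atBot :=
        tendsto_id.atTop_mul_const_of_neg (sub_neg.2 h)
      have h2 := (Real.continuous_exp.tendsto _).comp ((Real.tendsto_exp_atBot.comp h1).neg)
      simpa [Function.comp_def] using (h2.const_sub 1).const_mul (l * Real.exp (-l * t))

/-- The function `s ↦ ∑ n, c n * lam n * (s + lam n)⁻¹`. -/
noncomputable def resolventSum (lam : ℕ → ℝ) (c : ℕ → ℂ) (s : ℂ) : ℂ :=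
  ∑' n : ℕ, c n * (lam n : ℂ) * (s + (lam n : ℂ))⁻¹

theorem norm_resolventSum_term_le {l s : ℝ} (hl : 0 < l) (hs : 0 < s) (z : ℂ) :
    ‖z * (l : ℂ) * ((s : ℂ) + (l : ℂ))⁻¹‖ ≤ ‖z‖ := by
  rw [← Complex.ofReal_add, ← Complex.ofReal_inv, mul_assoc, ← Complex.ofReal_mul, norm_mul,
    Complex.norm_real, Real.norm_of_nonneg (by positivity), ← div_eq_mul_inv]
  exact mul_le_of_le_one_right (norm_nonneg _) ((div_le_one (by positivity)).2 (by linarith))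

section

variable {lam : ℕ → ℝ} {c : ℕ → ℂ}

theorem summable_resolventSum (hpos : ∀ n, 0 < lam n) (hc : Summable fun n => ‖c n‖)
    {s : ℝ} (hs : 0 < s) :
    Summable fun n => c n * (lam n : ℂ) * ((s : ℂ) + (lam n : ℂ))⁻¹ :=
  Summable.of_norm_bounded hc fun n => norm_resolventSum_term_le (hpos n) hs (c n)

theorem norm_resolventSum_le (hpos : ∀ n, 0 < lam n) (hc : Summable fun n => ‖c n‖)
    {s : ℝ} (hs : 0 < s) : ‖resolventSum lam c s‖ ≤ ∑' n, ‖c n‖ :=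
  tsum_of_norm_bounded hc.hasSum fun n => norm_resolventSum_term_le (hpos n) hs (c n)

theorem tsum_smoothedExpCDF_eq (hpos : ∀ n, 0 < lam n) (hc : Summable fun n => ‖c n‖)
    {s : ℝ} (hs : 0 < s) (x : ℝ) :
    ∑' n, c n * (smoothedExpCDF (lam n) x s : ℂ) =
      ∑' k : ℕ, (((-1) ^ k / ((k + 1).factorial : ℝ) * Real.exp (s * x) ^ (k + 1) : ℝ) : ℂ) *
        resolventSum lam c (((k + 1) * s : ℝ) : ℂ) := by
  set w : ℕ → ℝ := fun k => (-1) ^ k / ((k + 1).factorial : ℝ) * Real.exp (s * x) ^ (k + 1)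
  have hw : ∀ k, ‖(w k : ℂ)‖ = Real.exp (s * x) ^ (k + 1) / ((k + 1).factorial : ℝ) := by
    intro k
    rw [Complex.norm_real, norm_mul, norm_div, norm_pow, norm_neg, norm_one, one_pow,
      Real.norm_of_nonneg (by positivity), Real.norm_of_nonneg (by positivity)]
    ring
  have hks : ∀ k : ℕ, 0 < ((k : ℝ) + 1) * s := fun k => by positivity
  have hsum : Summable (Function.uncurry fun n k : ℕ => (w k : ℂ) *
      (c n * (lam n : ℂ) * ((((k + 1) * s : ℝ) : ℂ) + (lam n : ℂ))⁻¹)) := by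
    refine Summable.of_norm_bounded (hc.mul_of_nonneg
      ((summable_nat_add_iff 1).2 (Real.summable_pow_div_factorial (Real.exp (s * x))))
      (fun _ => norm_nonneg _) (fun _ => by positivity)) ?_
    rintro ⟨n, k⟩
    rw [Function.uncurry_apply_pair, norm_mul, hw, mul_comm]
    exact mul_le_mul_of_nonneg_right (norm_resolventSum_term_le (hpos n) (hks k) _)
      (by positivity)
  calc ∑' n, c n * (smoothedExpCDF (lam n) x s : ℂ)
      = ∑' (n : ℕ) (k : ℕ), (w k : ℂ) *
          (c n * (lam n : ℂ) * ((((k + 1) * s : ℝ) : ℂ) + (lam n : ℂ))⁻¹) := by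
        refine tsum_congr fun n => ?_
        have h := (Complex.hasSum_ofReal.2 (hasSum_smoothedExpCDF (hpos n) hs x)).mul_left (c n)
        rw [← h.tsum_eq]
        refine tsum_congr fun k => ?_
        simp only [w]
        push_cast
        ring
    _ = _ := by
        rw [← hsum.tsum_comm]
        exact tsum_congr fun k => tsum_mul_left

/-- Exponential decay of `resolventSum` along the positive reals forces the integrated
exponential sum to vanish near the origin. -/
theorem tsum_mul_one_sub_exp_eq_zero (hpos : ∀ n, 0 < lam n) (hc : Summable fun n => ‖c n‖)
    {δ C : ℝ} (hC : 0 ≤ C)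
    (hdecay : ∀ s : ℝ, 0 < s → ‖resolventSum lam c s‖ ≤ C * Real.exp (-δ * s))
    {x : ℝ} (hx : 0 < x) (hxδ : x < δ) :
    ∑' n, c n * ((1 - Real.exp (-lam n * x) : ℝ) : ℂ) = 0 := by
  have h1 : Tendsto (fun s => ∑' n, c n * (smoothedExpCDF (lam n) x s : ℂ)) atTop
      (𝓝 (∑' n, c n * ((1 - Real.exp (-lam n * x) : ℝ) : ℂ))) := by
    refine tendsto_tsum_of_dominated_convergence hc (fun n => ?_)
      (Eventually.of_forall fun s n => ?_)
    · exact ((Complex.continuous_ofReal.tendsto _).comp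
        (tendsto_smoothedExpCDF (hpos n) hx)).const_mul _
    · rw [norm_mul, Complex.norm_real]
      exact mul_le_of_le_one_right (norm_nonneg _) (norm_smoothedExpCDF_le (hpos n) x s)
  refine tendsto_nhds_unique h1 ?_
  have hfac : Summable fun k : ℕ => (1 : ℝ) ^ (k + 1) / ((k + 1).factorial : ℝ) :=
    (summable_nat_add_iff 1).2 (Real.summable_pow_div_factorial 1)
  have h2 : Tendsto (fun s : ℝ => C * Real.exp (-((δ - x) * s)) *
      ∑' k : ℕ, (1 : ℝ) ^ (k + 1) / ((k + 1).factorial : ℝ)) atTop (𝓝 0) := by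
    have h := Real.tendsto_exp_neg_atTop_nhds_zero.comp
      ((tendsto_id (α := ℝ)).const_mul_atTop (sub_pos.2 hxδ))
    simpa [Function.comp_def] using (h.const_mul C).mul_const
      (∑' k : ℕ, (1 : ℝ) ^ (k + 1) / ((k + 1).factorial : ℝ))
  refine squeeze_zero_norm' ?_ h2
  filter_upwards [eventually_gt_atTop 0] with s hs
  rw [tsum_smoothedExpCDF_eq hpos hc hs]
  refine tsum_of_norm_bounded (hfac.hasSum.mul_left _) fun k => ?_
  rw [norm_mul, Complex.norm_real, norm_mul, norm_div, norm_pow, norm_neg, norm_one, one_pow,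
      Real.norm_of_nonneg (by positivity), Real.norm_of_nonneg (by positivity)]
  have hexp : Real.exp (s * x) ^ (k + 1) * Real.exp (-δ * ((k + 1) * s))
      ≤ Real.exp (-((δ - x) * s)) := by
    rw [← Real.exp_nat_mul, ← Real.exp_add]
    refine Real.exp_le_exp.2 ?_
    have : 0 ≤ (k : ℝ) * ((δ - x) * s) :=
      mul_nonneg k.cast_nonneg (mul_nonneg (sub_pos.2 hxδ).le hs.le)
    push_cast
    linarith
  calc _ ≤ 1 / ((k + 1).factorial : ℝ) * Real.exp (s * x) ^ (k + 1) *
        (C * Real.exp (-δ * ((k + 1) * s))) :=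
        mul_le_mul_of_nonneg_left (hdecay _ (by positivity)) (by positivity)
    _ = C * (Real.exp (s * x) ^ (k + 1) * Real.exp (-δ * ((k + 1) * s))) *
        (1 / ((k + 1).factorial : ℝ)) := by ring
    _ ≤ _ := by
        rw [one_pow]
        gcongr

/-- Uniqueness for absolutely convergent general Dirichlet series. -/
theorem eq_zero_of_tsum_exp_eq_zero (hmono : StrictMono lam) (hc : Summable fun n => ‖c n‖)
    (h : ∀ x : ℝ, 0 < x → ∑' n, c n * (Real.exp (-lam n * x) : ℂ) = 0) : c = 0 := by
  funext m
  induction m using Nat.strong_induction_on with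
  | _ m ih =>
    have h1 : Tendsto (fun x : ℝ => ∑' n, c n * (Real.exp (-(lam n - lam m) * x) : ℂ)) atTop
        (𝓝 (∑' n, if n = m then c m else 0)) := by
      refine tendsto_tsum_of_dominated_convergence hc (fun n => ?_) ?_
      · rcases lt_trichotomy n m with hn | rfl | hn
        · simp [ih n hn, hn.ne]
        · simp
        · have h := Real.tendsto_exp_neg_atTop_nhds_zero.comp
            ((tendsto_id (α := ℝ)).const_mul_atTop (sub_pos.2 (hmono hn)))
          have h' := ((Complex.continuous_ofReal.tendsto _).comp h).const_mul (c n)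
          simpa [Function.comp_def, hn.ne', neg_mul, -neg_sub] using h'
      · filter_upwards [eventually_gt_atTop 0] with x hx n
        rcases lt_or_ge n m with hn | hn
        · simp [ih n hn]
        · rw [norm_mul, Complex.norm_real, Real.norm_of_nonneg (Real.exp_nonneg _)]
          refine mul_le_of_le_one_right (norm_nonneg _) (Real.exp_le_one_iff.2 ?_)
          have : 0 ≤ (lam n - lam m) * x :=
            mul_nonneg (sub_nonneg.2 (hmono.monotone hn)) hx.le
          linarith
    rw [tsum_ite_eq] at h1
    refine tendsto_nhds_unique h1 (tendsto_const_nhds.congr' ?_)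
    filter_upwards [eventually_gt_atTop 0] with x hx
    have h2 : ∀ n, c n * (Real.exp (-(lam n - lam m) * x) : ℂ)
        = c n * (Real.exp (-lam n * x) : ℂ) * (Real.exp (lam m * x) : ℂ) := by
      intro n
      rw [mul_assoc, ← Complex.ofReal_mul, ← Real.exp_add]
      ring_nf
    simp_rw [h2]
    rw [tsum_mul_right, h x hx, zero_mul]
    rfl

theorem tsum_mul_one_sub_exp_eq_zero_of_near_zero (hpos : ∀ n, 0 < lam n)
    (hc : Summable fun n => ‖c n‖) {δ : ℝ} (hδ : 0 < δ)
    (h : ∀ x : ℝ, 0 < x → x < δ → ∑' n, c n * ((1 - Real.exp (-lam n * x) : ℝ) : ℂ) = 0)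
    {x : ℝ} (hx : 0 < x) : ∑' n, c n * ((1 - Real.exp (-lam n * x) : ℝ) : ℂ) = 0 := by
  have hopen : IsOpen {z : ℂ | 0 < z.re} := isOpen_lt continuous_const Complex.continuous_re
  have hdiff : DifferentiableOn ℂ (fun z : ℂ => ∑' n, c n * (1 - Complex.exp (-lam n * z)))
      {z : ℂ | 0 < z.re} := by
    refine Complex.differentiableOn_tsum_of_summable_norm (hc.mul_right 2) (fun n => ?_) hopen
      fun n z hz => ?_
    · fun_prop
    · rw [norm_mul]
      refine mul_le_mul_of_nonneg_left ((norm_sub_le _ _).trans ?_) (norm_nonneg _)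
      have : 0 < lam n * z.re := mul_pos (hpos n) hz
      have h2 : ‖Complex.exp (-lam n * z)‖ ≤ 1 := by
        rw [Complex.norm_exp, Real.exp_le_one_iff]
        simp [this.le]
      rw [norm_one]
      linarith
  have hreal : ∀ y : ℝ, ∑' n, c n * (1 - Complex.exp (-lam n * (y : ℂ)))
      = ∑' n, c n * ((1 - Real.exp (-lam n * y) : ℝ) : ℂ) := fun y => by push_cast; rfl
  have hfreq : ∃ᶠ z : ℂ in 𝓝[≠] ((δ / 2 : ℝ) : ℂ),
      ∑' n, c n * (1 - Complex.exp (-lam n * z)) = (fun _ => (0 : ℂ)) z := by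
    have ht : Tendsto (fun y : ℝ => (y : ℂ)) (𝓝[≠] (δ / 2)) (𝓝[≠] ((δ / 2 : ℝ) : ℂ)) :=
      tendsto_nhdsWithin_of_tendsto_nhds_of_eventually_within _
        (Complex.continuous_ofReal.continuousAt.tendsto.mono_left nhdsWithin_le_nhds)
        (eventually_mem_nhdsWithin.mono fun y hy => Complex.ofReal_injective.ne hy)
    refine ht.frequently (Eventually.frequently ?_)
    filter_upwards [nhdsWithin_le_nhds (Ioo_mem_nhds (half_pos hδ) (half_lt_self hδ))] with y hy
    rw [hreal]
    exact h y hy.1 hy.2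
  have heq := (hdiff.analyticOnNhd hopen).eqOn_of_preconnected_of_frequently_eq
    (analyticOnNhd_const (v := (0 : ℂ))) (convex_halfSpace_re_gt 0).isPreconnected
    (z₀ := ((δ / 2 : ℝ) : ℂ)) (by simpa using hδ) hfreq
  rw [← hreal]
  exact heq (by simpa using hx)

theorem eq_zero_of_norm_resolventSum_le (hpos : ∀ n, 0 < lam n) (hmono : StrictMono lam)
    (hc : Summable fun n => ‖c n‖) {δ C : ℝ} (hδ : 0 < δ) (hC : 0 ≤ C)
    (hdecay : ∀ s : ℝ, 0 < s → ‖resolventSum lam c s‖ ≤ C * Real.exp (-δ * s)) : c = 0 := by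
  have h0 : ∀ x : ℝ, 0 < x → ∑' n, c n * ((1 - Real.exp (-lam n * x) : ℝ) : ℂ) = 0 :=
    fun x hx => tsum_mul_one_sub_exp_eq_zero_of_near_zero hpos hc hδ
      (fun y hy hyδ => tsum_mul_one_sub_exp_eq_zero hpos hc hC hdecay hy hyδ) hx
  have hle : ∀ x : ℝ, 0 < x → ∀ n, Real.exp (-lam n * x) ≤ 1 := fun x hx n =>
    Real.exp_le_one_iff.2 (by nlinarith [mul_pos (hpos n) hx])
  have hsplit : ∀ x : ℝ, 0 < x → ∑' n, c n * (Real.exp (-lam n * x) : ℂ) = ∑' n, c n := by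
    intro x hx
    have hs : Summable fun n => c n * (Real.exp (-lam n * x) : ℂ) := by
      refine Summable.of_norm_bounded hc fun n => ?_
      rw [norm_mul, Complex.norm_real, Real.norm_of_nonneg (Real.exp_nonneg _)]
      exact mul_le_of_le_one_right (norm_nonneg _) (hle x hx n)
    refine (sub_eq_zero.1 ?_).symm
    rw [← hc.of_norm.tsum_sub hs, ← h0 x hx]
    refine tsum_congr fun n => ?_
    push_cast
    ring
  have hlim : Tendsto (fun x : ℝ => ∑' n, c n * (Real.exp (-lam n * x) : ℂ)) atTop
      (𝓝 (∑' _ : ℕ, (0 : ℂ))) := by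
    refine tendsto_tsum_of_dominated_convergence hc (fun n => ?_) ?_
    · have h := Real.tendsto_exp_neg_atTop_nhds_zero.comp
        ((tendsto_id (α := ℝ)).const_mul_atTop (hpos n))
      simpa [Function.comp_def, neg_mul] using
        ((Complex.continuous_ofReal.tendsto _).comp h).const_mul (c n)
    · filter_upwards [eventually_gt_atTop 0] with x hx n
      rw [norm_mul, Complex.norm_real, Real.norm_of_nonneg (Real.exp_nonneg _)]
      exact mul_le_of_le_one_right (norm_nonneg _) (hle x hx n)
  have hzero : ∑' n, c n = 0 := by
    rw [tsum_zero] at hlim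
    refine tendsto_nhds_unique (tendsto_const_nhds.congr' ?_) hlim
    filter_upwards [eventually_gt_atTop 0] with x hx
    exact (hsplit x hx).symm
  exact eq_zero_of_tsum_exp_eq_zero hmono hc fun x hx => (hsplit x hx).trans hzero

theorem eq_zero_of_sum_exp_mul_resolventSum_eq_zero (hpos : ∀ n, 0 < lam n)
    (hmono : StrictMono lam) (T : Finset ℝ) (d : ℝ → ℕ → ℂ)
    (hd : ∀ τ ∈ T, Summable fun n => ‖d τ n‖)
    (h : ∀ s : ℝ, 0 < s →
      ∑ τ ∈ T, (Real.exp (-τ * s) : ℂ) * resolventSum lam (d τ) s = 0) :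
    ∀ τ ∈ T, d τ = 0 := by
  induction T using Finset.induction_on_min with
  | empty => simp
  | insert a S haS ih =>
    have haS' : a ∉ S := fun h => lt_irrefl a (haS a h)
    obtain ⟨δ, hδ, hgap⟩ : ∃ δ > 0, ∀ τ ∈ S, a + δ ≤ τ := by
      rcases S.eq_empty_or_nonempty with rfl | hS
      · exact ⟨1, one_pos, by simp⟩
      · exact ⟨S.min' hS - a, sub_pos.2 (haS _ (S.min'_mem hS)), fun τ hτ => by
          linarith [S.min'_le τ hτ]⟩
    have hda : d a = 0 := by
      refine eq_zero_of_norm_resolventSum_le hpos hmono (hd a (S.mem_insert_self a)) hδ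
        (C := ∑ τ ∈ S, ∑' n, ‖d τ n‖)
        (Finset.sum_nonneg fun τ _ => tsum_nonneg fun n => norm_nonneg _) fun s hs => ?_
      have h1 := h s hs
      rw [Finset.sum_insert haS'] at h1
      have h2 : resolventSum lam (d a) s =
          -∑ τ ∈ S, (Real.exp (-(τ - a) * s) : ℂ) * resolventSum lam (d τ) s := by
        have h3 : ∀ τ, (Real.exp (-(τ - a) * s) : ℂ)
            = (Real.exp (a * s) : ℂ) * (Real.exp (-τ * s) : ℂ) := by
          intro τ
          rw [← Complex.ofReal_mul, ← Real.exp_add]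
          ring_nf
        have h4 : (Real.exp (a * s) : ℂ) * (Real.exp (-a * s) : ℂ) = 1 := by
          rw [← h3, sub_self, neg_zero, zero_mul, Real.exp_zero, Complex.ofReal_one]
        simp_rw [h3, mul_assoc]
        rw [← Finset.mul_sum, ← sub_eq_zero, sub_neg_eq_add]
        linear_combination (Real.exp (a * s) : ℂ) * h1 - resolventSum lam (d a) s * h4
      rw [h2, norm_neg, Finset.sum_mul]
      refine norm_sum_le_of_le _ fun τ hτ => ?_
      rw [norm_mul, Complex.norm_real, Real.norm_of_nonneg (Real.exp_nonneg _), mul_comm]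
      refine mul_le_mul (norm_resolventSum_le hpos (hd τ (Finset.mem_insert_of_mem hτ)) hs)
        (Real.exp_le_exp.2 ?_) (Real.exp_nonneg _) (tsum_nonneg fun n => norm_nonneg _)
      nlinarith [mul_nonneg (sub_nonneg.2 (hgap τ hτ)) hs.le]
    have hS : ∀ τ ∈ S, d τ = 0 := by
      refine ih (fun τ hτ => hd τ (Finset.mem_insert_of_mem hτ)) fun s hs => ?_
      have h1 := h s hs
      rw [Finset.sum_insert haS', hda] at h1
      simpa [resolventSum] using h1
    intro τ hτ
    rcases Finset.mem_insert.1 hτ with rfl | hτ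
    · exact hda
    · exact hS τ hτ

theorem resolventSum_sub (hpos : ∀ n, 0 < lam n) {c d : ℕ → ℂ} (hc : Summable fun n => ‖c n‖)
    (hd : Summable fun n => ‖d n‖) {s : ℝ} (hs : 0 < s) :
    resolventSum lam (c - d) s = resolventSum lam c s - resolventSum lam d s := by
  rw [resolventSum, resolventSum, resolventSum,
    ← (summable_resolventSum hpos hc hs).tsum_sub (summable_resolventSum hpos hd hs)]
  refine tsum_congr fun n => ?_
  rw [Pi.sub_apply]
  ring

theorem resolventSum_sum (hpos : ∀ n, 0 < lam n) {ι : Type*} (S : Finset ι) {c : ι → ℕ → ℂ}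
    (hc : ∀ i ∈ S, Summable fun n => ‖c i n‖) {s : ℝ} (hs : 0 < s) :
    resolventSum lam (∑ i ∈ S, c i) s = ∑ i ∈ S, resolventSum lam (c i) s := by
  simp only [resolventSum]
  rw [← Summable.tsum_finsetSum fun i hi => summable_resolventSum hpos (hc i hi) hs]
  refine tsum_congr fun n => ?_
  rw [Finset.sum_apply, Finset.sum_mul, Finset.sum_mul]

end

section StepFunction

variable {V : Type*} [AddCommGroup V]

/-- The jump at the `k`-th mesh point of the step function that takes the value `a k` on the
`k`-th of `K` cells and vanishes elsewhere. -/
def stepJump (K : ℕ) (a : ℕ → V) : ℕ → V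
  | 0 => if 0 < K then a 0 else 0
  | k + 1 => (if k + 1 < K then a (k + 1) else 0) - if k < K then a k else 0

/-- The jump at time `τ` of the step function with mesh `t` and values `a`. -/
noncomputable def jumpAt (K : ℕ) (t : ℕ → ℝ) (a : ℕ → V) (τ : ℝ) : V :=
  ∑ k ∈ Finset.range (K + 1), if t k = τ then stepJump K a k else 0

theorem stepJump_ne_zero {K : ℕ} {a : ℕ → V} (hK : 1 ≤ K) (ha0 : ∀ k < K, a k ≠ 0)
    (hane : ∀ k, k + 1 < K → a k ≠ a (k + 1)) {k : ℕ} (hk : k ≤ K) : stepJump K a k ≠ 0 := by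
  cases k with
  | zero => simpa [stepJump, Nat.lt_of_succ_le hK] using ha0 0 hK
  | succ k =>
    have hk' : k < K := hk
    by_cases h : k + 1 < K
    · simpa [stepJump, h, hk', sub_eq_zero] using (hane k h).symm
    · simpa [stepJump, h, hk'] using ha0 k hk'

theorem eq_of_stepJump_eq {K : ℕ} {a b : ℕ → V}
    (h : ∀ k < K, stepJump K a k = stepJump K b k) {k : ℕ} (hk : k < K) : a k = b k := by
  induction k with
  | zero => simpa [stepJump, hk] using h 0 hk
  | succ k ih =>
    have hk' : k < K := (Nat.lt_succ_self k).trans hk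
    have h1 := h (k + 1) hk
    simpa [stepJump, hk, hk', ih hk'] using h1

theorem lt_of_mesh {K : ℕ} {t : ℕ → ℝ} (ht : ∀ k < K, t k < t (k + 1)) {i j : ℕ} (hij : i < j)
    (hj : j ≤ K) : t i < t j := by
  induction j, hij using Nat.le_induction with
  | base => exact ht i hj
  | succ j _ ih => exact (ih (Nat.le_of_succ_le hj)).trans (ht j hj)

theorem jumpAt_mesh {K : ℕ} {t : ℕ → ℝ} (ht : ∀ k < K, t k < t (k + 1)) (a : ℕ → V) {k : ℕ}
    (hk : k ≤ K) : jumpAt K t a (t k) = stepJump K a k := by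
  rw [jumpAt, Finset.sum_eq_single k]
  · simp
  · intro j hj hjk
    have hj' : j ≤ K := Nat.lt_succ_iff.1 (Finset.mem_range.1 hj)
    refine if_neg ?_
    rcases lt_or_gt_of_ne hjk with h | h
    · exact (lt_of_mesh ht h hk).ne
    · exact (lt_of_mesh ht h hj').ne'
  · intro h
    exact absurd (Finset.mem_range.2 (Nat.lt_succ_iff.2 hk)) h

theorem exists_mesh_of_jumpAt_ne_zero {K : ℕ} {t : ℕ → ℝ} {a : ℕ → V} {τ : ℝ}
    (h : jumpAt K t a τ ≠ 0) : ∃ k ≤ K, t k = τ := by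
  obtain ⟨k, hk, hne⟩ := Finset.exists_ne_zero_of_sum_ne_zero h
  exact ⟨k, Nat.lt_succ_iff.1 (Finset.mem_range.1 hk), by_contra fun h' => hne (if_neg h')⟩

/-- A step function without trivial cells or trivial jumps determines its mesh and values. -/
theorem mesh_and_values_eq_of_jumpAt_eq {K K' : ℕ} (hK : 1 ≤ K) (hK' : 1 ≤ K') {t t' : ℕ → ℝ}
    (ht : ∀ k < K, t k < t (k + 1)) (ht' : ∀ k < K', t' k < t' (k + 1)) {a b : ℕ → V}
    (ha0 : ∀ k < K, a k ≠ 0) (hb0 : ∀ k < K', b k ≠ 0)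
    (hane : ∀ k, k + 1 < K → a k ≠ a (k + 1)) (hbne : ∀ k, k + 1 < K' → b k ≠ b (k + 1))
    (h : ∀ τ, jumpAt K t a τ = jumpAt K' t' b τ) :
    K = K' ∧ (∀ k ≤ K, t k = t' k) ∧ ∀ k < K, a k = b k := by
  have hsub : ∀ k ≤ K, ∃ j ≤ K', t' j = t k := fun k hk =>
    exists_mesh_of_jumpAt_ne_zero (a := b)
      (by rw [← h, jumpAt_mesh ht a hk]; exact stepJump_ne_zero hK ha0 hane hk)
  have hsub' : ∀ k ≤ K', ∃ j ≤ K, t j = t' k := fun k hk =>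
    exists_mesh_of_jumpAt_ne_zero (a := a)
      (by rw [h, jumpAt_mesh ht' b hk]; exact stepJump_ne_zero hK' hb0 hbne hk)
  have hsm : StrictMono fun i : Fin (K + 1) => t i := fun i j hij =>
    lt_of_mesh ht hij (Nat.lt_succ_iff.1 j.2)
  have hsm' : StrictMono fun i : Fin (K' + 1) => t' i := fun i j hij =>
    lt_of_mesh ht' hij (Nat.lt_succ_iff.1 j.2)
  have himage : Finset.univ.image (fun i : Fin (K + 1) => t i)
      = Finset.univ.image (fun i : Fin (K' + 1) => t' i) := by
    ext τ
    simp only [Finset.mem_image, Finset.mem_univ, true_and]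
    constructor
    · rintro ⟨i, rfl⟩
      obtain ⟨j, hj, hjk⟩ := hsub i (Nat.lt_succ_iff.1 i.2)
      exact ⟨⟨j, Nat.lt_succ_iff.2 hj⟩, hjk⟩
    · rintro ⟨i, rfl⟩
      obtain ⟨j, hj, hjk⟩ := hsub' i (Nat.lt_succ_iff.1 i.2)
      exact ⟨⟨j, Nat.lt_succ_iff.2 hj⟩, hjk⟩
  have hcard := congrArg Finset.card himage
  rw [Finset.card_image_of_injective _ hsm.injective,
    Finset.card_image_of_injective _ hsm'.injective, Finset.card_univ, Finset.card_univ,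
    Fintype.card_fin, Fintype.card_fin] at hcard
  obtain rfl : K = K' := Nat.succ_injective hcard
  have hfun : (fun i : Fin (K + 1) => t i) = fun i : Fin (K + 1) => t' i := by
    have hc : (Finset.univ.image (fun i : Fin (K + 1) => t i)).card = K + 1 := by
      rw [Finset.card_image_of_injective _ hsm.injective, Finset.card_univ, Fintype.card_fin]
    rw [Finset.orderEmbOfFin_unique hc (fun i => Finset.mem_image_of_mem _ (Finset.mem_univ i)) hsm,
      Finset.orderEmbOfFin_unique hc
        (fun i => himage ▸ Finset.mem_image_of_mem _ (Finset.mem_univ i)) hsm']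
  have hteq : ∀ k ≤ K, t k = t' k := fun k hk =>
    congrFun hfun ⟨k, Nat.lt_succ_iff.2 hk⟩
  refine ⟨rfl, hteq, fun k hk => eq_of_stepJump_eq (fun j hj => ?_) hk⟩
  rw [← jumpAt_mesh ht a hj.le, ← jumpAt_mesh ht' b hj.le, h, hteq j hj.le]

end StepFunction

theorem summable_norm_truncate {K : ℕ} {a : ℕ → ℕ → ℂ} (ha : ∀ k < K, Summable fun n => ‖a k n‖)
    (k : ℕ) : Summable fun n => ‖(if k < K then a k else 0 : ℕ → ℂ) n‖ := by
  split_ifs with h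
  · exact ha k h
  · simp

theorem summable_norm_stepJump {K : ℕ} {a : ℕ → ℕ → ℂ} (ha : ∀ k < K, Summable fun n => ‖a k n‖)
    (k : ℕ) : Summable fun n => ‖stepJump K a k n‖ := by
  cases k with
  | zero => exact summable_norm_truncate ha 0
  | succ k =>
    exact Summable.of_nonneg_of_le (fun _ => norm_nonneg _) (fun _ => norm_sub_le _ _)
      ((summable_norm_truncate ha (k + 1)).add (summable_norm_truncate ha k))

theorem summable_norm_ite_stepJump {K : ℕ} {a : ℕ → ℕ → ℂ}
    (ha : ∀ k < K, Summable fun n => ‖a k n‖) (k : ℕ) (p : Prop) [Decidable p] :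
    Summable fun n => ‖(if p then stepJump K a k else 0) n‖ := by
  split_ifs
  · exact summable_norm_stepJump ha k
  · simp

theorem summable_norm_jumpAt {K : ℕ} {a : ℕ → ℕ → ℂ} (ha : ∀ k < K, Summable fun n => ‖a k n‖)
    (t : ℕ → ℝ) (τ : ℝ) : Summable fun n => ‖jumpAt K t a τ n‖ := by
  refine Summable.of_nonneg_of_le (fun _ => norm_nonneg _) (fun n => ?_)
    (summable_sum fun k (_ : k ∈ Finset.range (K + 1)) =>
      summable_norm_ite_stepJump ha k (t k = τ))
  rw [jumpAt, Finset.sum_apply]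
  exact norm_sum_le _ _

theorem sum_exp_sub_mul_resolventSum_eq_sum_stepJump {lam : ℕ → ℝ} (hpos : ∀ n, 0 < lam n)
    {K : ℕ} {a : ℕ → ℕ → ℂ} (ha : ∀ k < K, Summable fun n => ‖a k n‖) (E : ℕ → ℂ) {s : ℝ}
    (hs : 0 < s) :
    ∑ k ∈ Finset.range K, (E k - E (k + 1)) * resolventSum lam (a k) s =
      ∑ k ∈ Finset.range (K + 1), E k * resolventSum lam (stepJump K a k) s := by
  set e : ℕ → ℕ → ℂ := fun k => if k < K then a k else 0
  have he : ∀ k, Summable fun n => ‖e k n‖ := summable_norm_truncate ha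
  have hsucc : ∀ k, resolventSum lam (stepJump K a (k + 1)) s
      = resolventSum lam (e (k + 1)) s - resolventSum lam (e k) s := fun k =>
    resolventSum_sub hpos (he (k + 1)) (he k) hs
  have hlast : resolventSum lam (e K) s = 0 := by simp [e, resolventSum]
  have hleft : ∑ k ∈ Finset.range K, (E k - E (k + 1)) * resolventSum lam (a k) s
      = ∑ k ∈ Finset.range K, (E k - E (k + 1)) * resolventSum lam (e k) s :=
    Finset.sum_congr rfl fun k hk => by simp [e, Finset.mem_range.1 hk]
  have hshift := (Finset.sum_range_succ (fun k => E k * resolventSum lam (e k) s) K).symm.trans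
    (Finset.sum_range_succ' (fun k => E k * resolventSum lam (e k) s) K)
  rw [hlast, mul_zero, add_zero] at hshift
  rw [hleft, Finset.sum_range_succ', show stepJump K a 0 = e 0 from rfl]
  simp_rw [hsucc, mul_sub, sub_mul, Finset.sum_sub_distrib]
  rw [hshift]
  ring

theorem sum_exp_sub_mul_resolventSum_eq_sum_jumpAt {lam : ℕ → ℝ} (hpos : ∀ n, 0 < lam n)
    {K : ℕ} {a : ℕ → ℕ → ℂ} (ha : ∀ k < K, Summable fun n => ‖a k n‖) {t : ℕ → ℝ}
    {T : Finset ℝ} (hT : ∀ k ≤ K, t k ∈ T) {s : ℝ} (hs : 0 < s) :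
    ∑ k ∈ Finset.range K, ((Real.exp (-t k * s) : ℂ) - (Real.exp (-t (k + 1) * s) : ℂ)) *
        resolventSum lam (a k) s =
      ∑ τ ∈ T, (Real.exp (-τ * s) : ℂ) * resolventSum lam (jumpAt K t a τ) s := by
  rw [sum_exp_sub_mul_resolventSum_eq_sum_stepJump hpos ha
    (fun k => (Real.exp (-t k * s) : ℂ)) hs]
  have hjump : ∀ τ, resolventSum lam (jumpAt K t a τ) s = ∑ k ∈ Finset.range (K + 1),
      if t k = τ then resolventSum lam (stepJump K a k) s else 0 := by
    intro τ
    rw [jumpAt, resolventSum_sum hpos _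
      (fun k _ => summable_norm_ite_stepJump ha k (t k = τ)) hs]
    refine Finset.sum_congr rfl fun k _ => ?_
    split_ifs
    · rfl
    · simp [resolventSum]
  simp_rw [hjump, Finset.mul_sum]
  rw [Finset.sum_comm]
  refine Finset.sum_congr rfl fun k hk => ?_
  rw [Finset.sum_eq_single_of_mem (t k) (hT k (Nat.lt_succ_iff.1 (Finset.mem_range.1 hk)))]
  · simp
  · intro τ _ hτ
    rw [if_neg hτ.symm, mul_zero]

/-- Analytic core of the main uniqueness theorem (Theorem 1.2): equality of the two
Laplace-transformed data on the right half-plane forces the two meshes and the two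
families of coefficients to coincide. -/
theorem stmt_11 (lam : ℕ → ℝ) (hpos : ∀ n, 0 < lam n)
    (hmono : StrictMono lam) (hlim : Tendsto lam atTop atTop)
    (K K' : ℕ) (hK : 1 ≤ K) (hK' : 1 ≤ K')
    (tm tm' : ℕ → ℝ) (htm0 : 0 ≤ tm 0) (htm'0 : 0 ≤ tm' 0)
    (htm : ∀ k < K, tm k < tm (k + 1)) (htm' : ∀ k < K', tm' k < tm' (k + 1))
    (a b : ℕ → ℕ → ℂ)
    (ha : ∀ k < K, Summable fun n => ‖a k n‖)
    (hb : ∀ k < K', Summable fun n => ‖b k n‖)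
    (ha0 : ∀ k < K, a k ≠ 0) (hb0 : ∀ k < K', b k ≠ 0)
    (hane : ∀ k, k + 1 < K → a k ≠ a (k + 1))
    (hbne : ∀ k, k + 1 < K' → b k ≠ b (k + 1))
    (heq : ∀ s : ℂ, 0 < s.re →
      ∑ k ∈ Finset.range K,
          (Complex.exp (-(tm k : ℂ) * s) - Complex.exp (-(tm (k + 1) : ℂ) * s)) *
            ∑' n : ℕ, a k n * (lam n : ℂ) * (s + (lam n : ℂ))⁻¹
        = ∑ k ∈ Finset.range K',
            (Complex.exp (-(tm' k : ℂ) * s) - Complex.exp (-(tm' (k + 1) : ℂ) * s)) *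
              ∑' n : ℕ, b k n * (lam n : ℂ) * (s + (lam n : ℂ))⁻¹) :
    K = K' ∧ (∀ k ≤ K, tm k = tm' k) ∧ (∀ k < K, a k = b k) := by
  classical
  set T : Finset ℝ :=
    (Finset.range (K + 1)).image tm ∪ (Finset.range (K' + 1)).image tm'
  have hT : ∀ k ≤ K, tm k ∈ T := fun k hk => Finset.mem_union_left _
    (Finset.mem_image_of_mem _ (Finset.mem_range.2 (Nat.lt_succ_iff.2 hk)))
  have hT' : ∀ k ≤ K', tm' k ∈ T := fun k hk => Finset.mem_union_right _
    (Finset.mem_image_of_mem _ (Finset.mem_range.2 (Nat.lt_succ_iff.2 hk)))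
  have hA := summable_norm_jumpAt ha tm
  have hB := summable_norm_jumpAt hb tm'
  have hzero := eq_zero_of_sum_exp_mul_resolventSum_eq_zero hpos hmono T
    (fun τ => jumpAt K tm a τ - jumpAt K' tm' b τ)
    (fun τ _ => Summable.of_nonneg_of_le (fun _ => norm_nonneg _) (fun _ => norm_sub_le _ _)
      ((hA τ).add (hB τ)))
    (fun s hs => by
      simp_rw [resolventSum_sub hpos (hA _) (hB _) hs, mul_sub, Finset.sum_sub_distrib]
      rw [← sum_exp_sub_mul_resolventSum_eq_sum_jumpAt hpos ha hT hs,
        ← sum_exp_sub_mul_resolventSum_eq_sum_jumpAt hpos hb hT' hs, sub_eq_zero]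
      simpa [resolventSum] using heq s (by simpa using hs))
  refine mesh_and_values_eq_of_jumpAt_eq hK hK' htm htm' ha0 hb0 hane hbne fun τ => ?_
  by_cases hτ : τ ∈ T
  · exact sub_eq_zero.1 (hzero τ hτ)
  · have h1 : jumpAt K tm a τ = 0 := by
      by_contra h
      obtain ⟨k, hk, rfl⟩ := exists_mesh_of_jumpAt_ne_zero h
      exact hτ (hT k hk)
    have h2 : jumpAt K' tm' b τ = 0 := by
      by_contra h
      obtain ⟨k, hk, rfl⟩ := exists_mesh_of_jumpAt_ne_zero h
      exact hτ (hT' k hk)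
    rw [h1, h2]
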